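/- arXiv:2504.06449 — 7 statements merged into one kernel-verified Lean document; each statement's English description precedes it below -/
import Mathlib

section
/- Let κ ≥ 2 be an integer and let a, b, c ∈ ℝ be such that the matrix M_κ(a,b,c) is positive definite. Then |f(a,b,c)| ≤ 2 and |g(a,b,c)| ≤ 1. -/
/-- The matrix `M_κ(a,b,c)`: `a` on the diagonal, `b` in entries `(i,j)` with `i ≠ j`
and (`i = 0` or `j = 0`), and `c` elsewhere. -/
def Mmat (κ : ℕ) (a b c : ℝ) : Matrix (Fin (κ + 1)) (Fin (κ + 1)) ℝ :=
  Matrix.of fun i j => if i = j then a else if i = 0 ∨ j = 0 then b else c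

/-- `f(a,b,c) = b(a−c)/(a²−b²)`. -/
noncomputable def fFun (a b c : ℝ) : ℝ := b * (a - c) / (a ^ 2 - b ^ 2)

/-- `g(a,b,c) = (ac−b²)/(a²−b²)`. -/
noncomputable def gFun (a b c : ℝ) : ℝ := (a * c - b ^ 2) / (a ^ 2 - b ^ 2)

/-- The quadratic form of `M_κ(a,b,c)` on the first three coordinates. -/
theorem Mmat_posDef_quadratic {κ : ℕ} (hκ : 2 ≤ κ) {a b c : ℝ} (h : (Mmat κ a b c).PosDef)
    (x y z : ℝ) (hx : ![x, y, z] ≠ 0) :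
    0 < a * (x ^ 2 + y ^ 2 + z ^ 2) + 2 * b * x * (y + z) + 2 * c * y * z := by
  have hle : 3 ≤ κ + 1 := by omega
  have hM : (Mmat κ a b c).submatrix (Fin.castLE hle) (Fin.castLE hle)
      = !![a, b, b; b, a, c; b, c, a] := by
    ext i j
    simp only [Mmat, Matrix.submatrix_apply, Matrix.of_apply, Fin.ext_iff, Fin.val_castLE,
      Fin.val_zero]
    fin_cases i <;> fin_cases j <;> simp
  have hsub := (h.submatrix (Fin.castLE_injective hle)).dotProduct_mulVec_pos hx
  rw [hM] at hsub
  simp [Matrix.mulVec, dotProduct, Fin.sum_univ_three] at hsub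
  linarith

/-- If `M_κ(a,b,c)` is positive definite then `|f(a,b,c)| ≤ 2`
and `|g(a,b,c)| ≤ 1`. -/
theorem stmt2 (κ : ℕ) (hκ : 2 ≤ κ) (a b c : ℝ) (h : (Mmat κ a b c).PosDef) :
    |fFun a b c| ≤ 2 ∧ |gFun a b c| ≤ 1 := by
  have ha : 0 < a := by simpa using Mmat_posDef_quadratic hκ h 1 0 0 (by simp)
  have hb : 0 < a + b := by linarith [Mmat_posDef_quadratic hκ h 1 1 0 (by simp)]
  have hb' : 0 < a - b := by linarith [Mmat_posDef_quadratic hκ h 1 (-1) 0 (by simp)]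
  have hc : 0 < a - c := by linarith [Mmat_posDef_quadratic hκ h 0 1 (-1) (by simp)]
  have hdet : 0 < a * (a + c) - 2 * b ^ 2 := by
    have hq := Mmat_posDef_quadratic hκ h (-2 * b) a a (by simp [ha.ne'])
    refine pos_of_mul_pos_right (a := 2 * a) ?_ (by positivity)
    linarith
  have hden : 0 < a ^ 2 - b ^ 2 := by linarith [mul_pos hb hb']
  have hac := mul_pos ha hc
  have hbc := mul_pos hb hc
  have hbc' := mul_pos hb' hc
  unfold fFun gFun
  constructor <;> rw [abs_le, le_div_iff₀ hden, div_le_iff₀ hden] <;> constructor <;> linarith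
end

section
/- Let κ ≥ 2 be an integer and α, β ∈ ℝ. Then there exists a constant C ∈ (0, ∞), depending only on α, β, κ, such that for every (a,b,c) ∈ ℝ³ with A := M_κ(a,b,c) positive definite, one has |α̃(A)| ≤ C, |β̃(A)| ≤ C, and every entry of the matrix L(A) has absolute value at most C. -/
open Matrix

/-- `Q`: the matrix whose only nonzero entry is a `1` in position `(0,0)`. -/
def Qmat (κ : ℕ) : Matrix (Fin (κ + 1)) (Fin (κ + 1)) ℝ :=
  Matrix.of fun i j => if i = 0 ∧ j = 0 then 1 else 0

/-- `P`: the matrix whose `(i,j)` entry is `1` iff `i = 0` and `j ≠ 0`. -/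
def Pmat (κ : ℕ) : Matrix (Fin (κ + 1)) (Fin (κ + 1)) ℝ :=
  Matrix.of fun i j => if i = 0 ∧ j ≠ 0 then 1 else 0

/-- `R`: the all-ones matrix. -/
def Rmat (κ : ℕ) : Matrix (Fin (κ + 1)) (Fin (κ + 1)) ℝ :=
  Matrix.of fun _ _ => 1

/-- `J := P + Pᵀ`. -/
def Jmat (κ : ℕ) : Matrix (Fin (κ + 1)) (Fin (κ + 1)) ℝ := Pmat κ + (Pmat κ)ᵀ

/-- `K := R − I − J`. -/
def Kmat (κ : ℕ) : Matrix (Fin (κ + 1)) (Fin (κ + 1)) ℝ := Rmat κ - 1 - Jmat κ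

/-- `α̃(M_κ(a,b,c)) = α + (β(κ−1)/κ)·f(a,b,c)`. -/
noncomputable def alphaTilde (κ : ℕ) (α β a b c : ℝ) : ℝ :=
  α + (β * ((κ : ℝ) - 1) / (κ : ℝ)) * fFun a b c

/-- `β̃(M_κ(a,b,c)) = β/κ + (β(κ−1)/κ)·g(a,b,c)`. -/
noncomputable def betaTilde (κ : ℕ) (α β a b c : ℝ) : ℝ :=
  β / (κ : ℝ) + (β * ((κ : ℝ) - 1) / (κ : ℝ)) * gFun a b c

/-- `L(M_κ(a,b,c)) = α·Q + α̃·(I − Q) + (β/κ)·P + β̃·Pᵀ`. -/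
noncomputable def Lmat (κ : ℕ) (α β a b c : ℝ) : Matrix (Fin (κ + 1)) (Fin (κ + 1)) ℝ :=
  α • Qmat κ + alphaTilde κ α β a b c • (1 - Qmat κ) + (β / (κ : ℝ)) • Pmat κ +
    betaTilde κ α β a b c • (Pmat κ)ᵀ

theorem Mmat_quadratic_form_pos {κ : ℕ} (hκ : 2 ≤ κ) {a b c : ℝ} (h : (Mmat κ a b c).PosDef)
    (x : Fin 3 → ℝ) (hx : x ≠ 0) :
    0 < a * (x 0 ^ 2 + x 1 ^ 2 + x 2 ^ 2) + 2 * b * x 0 * (x 1 + x 2) + 2 * c * x 1 * x 2 := by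
  have hle : 3 ≤ κ + 1 := by omega
  have hzero (i : Fin 3) : Fin.castLE hle i = 0 ↔ i = 0 := by
    rw [← Fin.val_inj, ← Fin.val_inj]; rfl
  have hp := (h.submatrix (Fin.castLE_injective hle)).dotProduct_mulVec_pos hx
  simp only [mulVec, dotProduct, Fin.sum_univ_three, Mmat, submatrix_apply, of_apply,
    (Fin.castLE_injective hle).eq_iff, hzero, Pi.star_apply, star_trivial] at hp
  simp at hp
  linarith

theorem Mmat_posDef_bounds {κ : ℕ} (hκ : 2 ≤ κ) {a b c : ℝ} (h : (Mmat κ a b c).PosDef) :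
    |b| < a ∧ c < a ∧ 2 * b ^ 2 < a * (a + c) := by
  have hq := Mmat_quadratic_form_pos hκ h
  have hadd := hq ![1, 1, 0] (by simp)
  have hsub := hq ![1, -1, 0] (by simp)
  have hdiff := hq ![0, 1, -1] (by simp)
  simp only [cons_val_zero, cons_val_one, cons_val] at hadd hsub hdiff
  have ha : 0 < a := by linarith
  have hdet := hq ![-2 * b, a, a] fun h0 => ha.ne' (by simpa using congrFun h0 1)
  simp only [cons_val_zero, cons_val_one, cons_val] at hdet
  refine ⟨abs_lt.2 ⟨by linarith, by linarith⟩, by linarith, ?_⟩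
  have hmul : 0 < (2 * a) * (a * (a + c) - 2 * b ^ 2) := by linarith
  linarith [pos_of_mul_pos_right hmul (by linarith)]

theorem abs_gFun_le_one {a b c : ℝ} (hb : |b| < a) (hc : c < a)
    (hdet : 2 * b ^ 2 < a * (a + c)) : |gFun a b c| ≤ 1 := by
  have ha : 0 < a := (abs_nonneg b).trans_lt hb
  have hd : 0 < a ^ 2 - b ^ 2 := by linarith [sq_lt_sq' (abs_lt.1 hb).1 (abs_lt.1 hb).2]
  rw [gFun, abs_div, abs_of_pos hd, div_le_one hd, abs_le]
  constructor <;> nlinarith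

theorem abs_fFun_le_two {a b c : ℝ} (hb : |b| < a) (hc : c < a)
    (hdet : 2 * b ^ 2 < a * (a + c)) : |fFun a b c| ≤ 2 := by
  have hd : 0 < a ^ 2 - b ^ 2 := by linarith [sq_lt_sq' (abs_lt.1 hb).1 (abs_lt.1 hb).2]
  have hac : 0 < a - c := sub_pos.2 hc
  rw [fFun, abs_div, abs_of_pos hd, div_le_iff₀ hd, abs_mul, abs_of_pos hac]
  calc |b| * (a - c) ≤ a * (a - c) := by gcongr
    _ ≤ 2 * (a ^ 2 - b ^ 2) := by linarith

theorem abs_Lmat_apply_le {κ : ℕ} {α β a b c C : ℝ} (hC : 0 ≤ C) (hα : |α| ≤ C)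
    (hβ : |β / κ| ≤ C) (hα' : |alphaTilde κ α β a b c| ≤ C) (hβ' : |betaTilde κ α β a b c| ≤ C)
    (i j : Fin (κ + 1)) : |Lmat κ α β a b c i j| ≤ C := by
  by_cases hi : i = 0 <;> by_cases hj : j = 0
  · simpa [Lmat, Qmat, Pmat, hi, hj] using hα
  · simpa [Lmat, Qmat, Pmat, hi, hj, Matrix.one_apply, Ne.symm hj] using hβ
  · simpa [Lmat, Qmat, Pmat, hi, hj] using hβ'
  · by_cases hij : i = j
    · simpa [Lmat, Qmat, Pmat, hj, hij] using hα'
    · simpa [Lmat, Qmat, Pmat, hi, hj, hij] using hC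

/-- The functionals `α̃`, `β̃` and the entries of `L` are uniformly
bounded over positive definite matrices `M_κ(a,b,c)`, by a constant depending only on
`α`, `β`, `κ`. -/
theorem stmt7 (κ : ℕ) (hκ : 2 ≤ κ) (α β : ℝ) :
    ∃ C : ℝ, 0 < C ∧ ∀ a b c : ℝ, (Mmat κ a b c).PosDef →
      |alphaTilde κ α β a b c| ≤ C ∧ |betaTilde κ α β a b c| ≤ C ∧
      ∀ i j : Fin (κ + 1), |Lmat κ α β a b c i j| ≤ C := by
  have hκ0 : (0 : ℝ) < κ := by exact_mod_cast (by omega : 0 < κ)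
  have hκ1 : (1 : ℝ) ≤ κ := by exact_mod_cast (by omega : 1 ≤ κ)
  have hβ : |β / (κ : ℝ)| ≤ |β| := by
    rw [abs_div, abs_of_pos hκ0]
    exact div_le_self (abs_nonneg β) hκ1
  have hcoef : |β * ((κ : ℝ) - 1) / (κ : ℝ)| ≤ |β| := by
    rw [abs_div, abs_mul, abs_of_pos hκ0, abs_of_nonneg (sub_nonneg.2 hκ1), div_le_iff₀ hκ0]
    gcongr
    linarith
  have hα0 := abs_nonneg α
  have hβ0 := abs_nonneg β
  refine ⟨|α| + 2 * |β| + 1, by positivity, fun a b c h => ?_⟩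
  obtain ⟨hb, hc, hdet⟩ := Mmat_posDef_bounds hκ h
  have hα' : |alphaTilde κ α β a b c| ≤ |α| + 2 * |β| + 1 := by
    have hmul := mul_le_mul hcoef (abs_fFun_le_two hb hc hdet) (abs_nonneg _) hβ0
    rw [← abs_mul] at hmul
    exact (abs_add_le _ _).trans (by linarith)
  have hβ' : |betaTilde κ α β a b c| ≤ |α| + 2 * |β| + 1 := by
    have hmul := mul_le_mul hcoef (abs_gFun_le_one hb hc hdet) (abs_nonneg _) hβ0
    rw [← abs_mul] at hmul
    exact (abs_add_le _ _).trans (by linarith)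
  exact ⟨hα', hβ', abs_Lmat_apply_le (by positivity) (by linarith) (by linarith) hα' hβ'⟩
end

section
/- Let κ ≥ 2 be an integer, α, β ∈ ℝ, and let Σ₀ = M_κ(a₀,b₀,c₀) be positive definite. Then there exists a unique function V : [0, ∞) → ℝ^{(1+κ)×(1+κ)} such that V(0) = Σ₀, for every t ≥ 0 the matrix V(t) is of the form M_κ(a_t,b_t,c_t) and is positive definite, and V is differentiable on [0, ∞) with V'(t) = F(V(t)) := 2I − L(V(t))·V(t) − V(t)·L(V(t))ᵀ for all t ≥ 0. In particular, the solution of this nonlinear matrix Riccati equation is global and remains in the positive definite cone. -/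
open Matrix

/-- `L(A)` as a function of the matrix `A = M_κ(a,b,c)` itself, reading off
`a = A 0 0`, `b = A 0 1`, `c = A 1 2`. -/
noncomputable def LmatA (κ : ℕ) (α β : ℝ) (A : Matrix (Fin (κ + 1)) (Fin (κ + 1)) ℝ) :
    Matrix (Fin (κ + 1)) (Fin (κ + 1)) ℝ :=
  Lmat κ α β (A 0 0) (A 0 1) (A 1 2)

/-- `F(A) := 2I − L(A)A − AL(A)ᵀ`. -/
noncomputable def FmatA (κ : ℕ) (α β : ℝ) (A : Matrix (Fin (κ + 1)) (Fin (κ + 1)) ℝ) :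
    Matrix (Fin (κ + 1)) (Fin (κ + 1)) ℝ :=
  (2 : ℝ) • (1 : Matrix (Fin (κ + 1)) (Fin (κ + 1)) ℝ)
    - LmatA κ α β A * A - A * (LmatA κ α β A)ᵀ

attribute [local instance] Matrix.normedAddCommGroup Matrix.normedSpace

section AutonomousODE

open Set Metric Filter Topology
open scoped Manifold NNReal

variable {E : Type*} [NormedAddCommGroup E] [NormedSpace ℝ E]

/-- A vector field of class `C¹` on an open set agrees on any compact subset with a bounded
globally Lipschitz vector field. -/
theorem exists_lipschitzWith_bounded_eqOn [FiniteDimensional ℝ E] {F : E → E} {U K : Set E}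
    (hU : IsOpen U) (hF : ContDiffOn ℝ 1 F U) (hK : IsCompact K) (hKU : K ⊆ U) :
    ∃ (G : E → E) (C L : ℝ≥0), LipschitzWith C G ∧ (∀ x, ‖G x‖ ≤ L) ∧ EqOn G F K := by
  obtain ⟨K', hK', hKK', hK'U⟩ := exists_compact_between hK hU hKU
  obtain ⟨χ, hχ1, hχ0, -⟩ := exists_contMDiffMap_one_nhds_of_subset_interior (n := 1)
    𝓘(ℝ, E) hK.isClosed hKK'
  have hχ : ContDiff ℝ 1 χ := χ.contMDiff.contDiff
  have hsupp : tsupport χ ⊆ K' :=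
    closure_minimal (fun x hx => by_contra fun h => hx (hχ0 x h)) hK'.isClosed
  have hG : ContDiff ℝ 1 fun x => χ x • F x := by
    rw [contDiff_iff_contDiffAt]
    intro x
    by_cases hx : x ∈ U
    · exact hχ.contDiffAt.smul (hF.contDiffAt (hU.mem_nhds hx))
    · have hx' : x ∉ tsupport χ := fun h => hx (hK'U (hsupp h))
      refine (contDiffAt_const (c := (0 : E))).congr_of_eventuallyEq ?_
      filter_upwards [notMem_tsupport_iff_eventuallyEq.1 hx'] with y hy
      simp [hy]
  have hc : HasCompactSupport fun x => χ x • F x :=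
    HasCompactSupport.intro hK' fun x hx => by simp [hχ0 x hx]
  obtain ⟨C, hC⟩ := hG.lipschitzWith_of_hasCompactSupport hc one_ne_zero
  obtain ⟨L, hL⟩ := hG.continuous.bounded_above_of_compact_support hc
  refine ⟨_, C, L.toNNReal, hC, fun x => (hL x).trans (Real.le_coe_toNNReal L), fun x hx => ?_⟩
  simp [hχ1.self_of_nhdsSet x hx]

/-- A bounded globally Lipschitz vector field has integral curves on any interval `[0, T]`. -/
theorem exists_hasDerivWithinAt_Icc_of_lipschitzWith [CompleteSpace E] {G : E → E} {C L : ℝ≥0}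
    (hC : LipschitzWith C G) (hL : ∀ x, ‖G x‖ ≤ L) (x₀ : E) {T : ℝ} (hT : 0 ≤ T) :
    ∃ u : ℝ → E, u 0 = x₀ ∧ ∀ t ∈ Icc 0 T, HasDerivWithinAt u (G (u t)) (Icc 0 T) t := by
  have hp : IsPicardLindelof (fun _ => G) (⟨0, left_mem_Icc.2 hT⟩ : Icc (0 : ℝ) T) x₀
      (L * T.toNNReal) 0 L C :=
    { lipschitzOnWith := fun _ _ => hC.lipschitzOnWith
      continuousOn := fun _ _ => continuousOn_const
      norm_le := fun _ _ x _ => hL x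
      mul_max_le := by simp [hT] }
  exact hp.exists_eq_forall_mem_Icc_hasDerivWithinAt₀

/-- Integral curves of a vector field of class `C¹` on an open set are determined by their
initial value. -/
theorem eqOn_Icc_of_contDiffOn [FiniteDimensional ℝ E] {F : E → E} {U : Set E}
    (hU : IsOpen U) (hF : ContDiffOn ℝ 1 F U) {u v : ℝ → E} {T : ℝ}
    (hu : ∀ t ∈ Icc 0 T, u t ∈ U ∧ HasDerivWithinAt u (F (u t)) (Icc 0 T) t)
    (hv : ∀ t ∈ Icc 0 T, v t ∈ U ∧ HasDerivWithinAt v (F (v t)) (Icc 0 T) t)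
    (h0 : u 0 = v 0) : EqOn u v (Icc 0 T) := by
  have huc : ContinuousOn u (Icc 0 T) := fun t ht => (hu t ht).2.continuousWithinAt
  have hvc : ContinuousOn v (Icc 0 T) := fun t ht => (hv t ht).2.continuousWithinAt
  obtain ⟨G, C, -, hC, -, hG⟩ := exists_lipschitzWith_bounded_eqOn hU hF
    ((isCompact_Icc.image_of_continuousOn huc).union (isCompact_Icc.image_of_continuousOn hvc))
    (union_subset (image_subset_iff.2 fun t ht => (hu t ht).1)
      (image_subset_iff.2 fun t ht => (hv t ht).1))
  have key : ∀ w : ℝ → E, (∀ t ∈ Icc 0 T, w t ∈ u '' Icc 0 T ∪ v '' Icc 0 T ∧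
      HasDerivWithinAt w (F (w t)) (Icc 0 T) t) →
      ∀ t ∈ Ico 0 T, HasDerivWithinAt w (G (w t)) (Ici t) t := by
    intro w hw t ht
    obtain ⟨h1, h2⟩ := hw t (Ico_subset_Icc_self ht)
    rw [hG h1]
    exact h2.mono_of_mem_nhdsWithin (mem_of_superset (Icc_mem_nhdsGE ht.2)
      (Icc_subset_Icc_left ht.1))
  exact ODE_solution_unique_of_mem_Icc_right (v := fun _ => G) (s := fun _ => univ) (K := C)
    (fun _ _ => hC.lipschitzOnWith) huc
    (key u fun t ht => ⟨Or.inl (mem_image_of_mem _ ht), (hu t ht).2⟩) (fun _ _ => mem_univ _) hvc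
    (key v fun t ht => ⟨Or.inr (mem_image_of_mem _ ht), (hv t ht).2⟩) (fun _ _ => mem_univ _) h0

/-- If integral curves staying in a compact set `K` actually stay in an open subset `O` of `K`,
then there is an integral curve on `[0, T]`. -/
theorem exists_hasDerivWithinAt_Icc_of_apriori [FiniteDimensional ℝ E] {F : E → E}
    {U K O : Set E} (hU : IsOpen U) (hF : ContDiffOn ℝ 1 F U) (hK : IsCompact K) (hKU : K ⊆ U)
    (hO : IsOpen O) (hOK : O ⊆ K) {x₀ : E} (hx₀ : x₀ ∈ O) {T : ℝ} (hT : 0 ≤ T)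
    (hap : ∀ (u : ℝ → E), ∀ t ∈ Icc 0 T, u 0 = x₀ →
      (∀ s ∈ Icc 0 t, u s ∈ K ∧ HasDerivWithinAt u (F (u s)) (Icc 0 t) s) → u t ∈ O) :
    ∃ u : ℝ → E, u 0 = x₀ ∧
      ∀ t ∈ Icc 0 T, u t ∈ K ∧ HasDerivWithinAt u (F (u t)) (Icc 0 T) t := by
  obtain ⟨G, C, L, hC, hL, hG⟩ := exists_lipschitzWith_bounded_eqOn hU hF hK hKU
  obtain ⟨u, hu0, hu⟩ := exists_hasDerivWithinAt_Icc_of_lipschitzWith hC hL x₀ hT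
  have huc : ContinuousOn u (Icc 0 T) := fun t ht => (hu t ht).continuousWithinAt
  have huO : ∀ t ∈ Icc 0 T, u t ∈ O := by
    by_contra! hne
    obtain ⟨t', ht', ht'O⟩ := hne
    have hcomp : IsCompact (Icc 0 T ∩ u ⁻¹' Oᶜ) :=
      isCompact_Icc.of_isClosed_subset
        (huc.preimage_isClosed_of_isClosed isClosed_Icc hO.isClosed_compl) inter_subset_left
    obtain ⟨t, ⟨htT, htO⟩, htmin⟩ := hcomp.exists_isLeast ⟨t', ht', ht'O⟩
    have hlt : ∀ s ∈ Ico 0 t, u s ∈ O := fun s hs => by_contra fun h =>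
      (htmin ⟨⟨hs.1, hs.2.le.trans htT.2⟩, h⟩).not_gt hs.2
    have ht0 : 0 < t := htT.1.lt_of_ne fun h => htO (by rw [← h, hu0]; exact hx₀)
    have hsub : Icc 0 t ⊆ Icc 0 T := Icc_subset_Icc_right htT.2
    have htK : u t ∈ K := by
      have hcw : ContinuousWithinAt u (Ico 0 t) t :=
        ((huc t htT).mono (Ico_subset_Icc_self.trans hsub))
      have := hcw.mem_closure (by rw [closure_Ico ht0.ne]; exact right_mem_Icc.2 ht0.le)
        (fun s hs => hOK (hlt s hs))
      rwa [hK.isClosed.closure_eq] at this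
    refine htO (hap u t htT hu0 fun s hs => ?_)
    have hsK : u s ∈ K := by
      rcases hs.2.lt_or_eq with h | h
      · exact hOK (hlt s ⟨hs.1, h⟩)
      · rwa [h]
    exact ⟨hsK, hG hsK ▸ (hu s (hsub hs)).mono hsub⟩
  exact ⟨u, hu0, fun t ht => ⟨hOK (huO t ht), hG (hOK (huO t ht)) ▸ hu t ht⟩⟩

/-- Integral curves on every interval `[0, T]` glue to an integral curve on `[0, ∞)`. -/
theorem exists_hasDerivWithinAt_Ici_of_Icc [FiniteDimensional ℝ E] {F : E → E} {U : Set E}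
    (hU : IsOpen U) (hF : ContDiffOn ℝ 1 F U) {S : Set E} (hSU : S ⊆ U) {x₀ : E}
    (h : ∀ T : ℝ, 0 ≤ T → ∃ u : ℝ → E, u 0 = x₀ ∧
      ∀ t ∈ Icc 0 T, u t ∈ S ∧ HasDerivWithinAt u (F (u t)) (Icc 0 T) t) :
    ∃ u : ℝ → E, u 0 = x₀ ∧ ∀ t, 0 ≤ t → u t ∈ S ∧ HasDerivWithinAt u (F (u t)) (Ici 0) t := by
  choose! w hw0 hw using h
  have hagree : ∀ T T' : ℝ, 0 ≤ T → T ≤ T' → EqOn (w T) (w T') (Icc 0 T) := by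
    intro T T' hT hTT'
    have hsub : Icc 0 T ⊆ Icc 0 T' := Icc_subset_Icc_right hTT'
    refine eqOn_Icc_of_contDiffOn hU hF (fun t ht => ⟨hSU (hw T hT t ht).1, (hw T hT t ht).2⟩)
      (fun t ht => ?_) ((hw0 T hT).trans (hw0 T' (hT.trans hTT')).symm)
    obtain ⟨h1, h2⟩ := hw T' (hT.trans hTT') t (hsub ht)
    exact ⟨hSU h1, h2.mono hsub⟩
  refine ⟨fun t => w t t, hw0 0 le_rfl, fun t ht => ⟨(hw t ht t (right_mem_Icc.2 ht)).1, ?_⟩⟩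
  have ht1 : 0 ≤ t + 1 := by linarith
  have heq : ∀ s ∈ Icc 0 (t + 1), w s s = w (t + 1) s := fun s hs =>
    hagree s (t + 1) hs.1 hs.2 (right_mem_Icc.2 hs.1)
  have htm : t ∈ Icc 0 (t + 1) := ⟨ht, by linarith⟩
  have hd : HasDerivWithinAt (fun s => w s s) (F (w (t + 1) t)) (Icc 0 (t + 1)) t :=
    (hw (t + 1) ht1 t htm).2.congr heq (heq t htm)
  show HasDerivWithinAt (fun s => w s s) (F (w t t)) (Ici 0) t
  rw [heq t htm]
  refine hd.mono_of_mem_nhdsWithin ?_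
  filter_upwards [self_mem_nhdsWithin, mem_nhdsWithin_of_mem_nhds (Iio_mem_nhds (lt_add_one t))]
    with s hs hs' using ⟨hs, le_of_lt hs'⟩

/-- Grönwall-type lower bound for a scalar differential inequality. -/
theorem mul_exp_neg_le_of_hasDerivWithinAt {x x' : ℝ → ℝ} {C t : ℝ} (ht : 0 ≤ t)
    (hx : ∀ s ∈ Icc 0 t, HasDerivWithinAt x (x' s) (Icc 0 t) s)
    (hle : ∀ s ∈ Icc 0 t, -(C * x s) ≤ x' s) : x 0 * Real.exp (-(C * t)) ≤ x t := by
  have hd : ∀ s ∈ Icc 0 t, HasDerivWithinAt (fun s => x s * Real.exp (C * s))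
      (x' s * Real.exp (C * s) + x s * (Real.exp (C * s) * (C * 1))) (Icc 0 t) s := fun s hs =>
    (hx s hs).mul (((hasDerivAt_id s).const_mul C).exp.hasDerivWithinAt)
  have hmono : MonotoneOn (fun s => x s * Real.exp (C * s)) (Icc 0 t) := by
    refine monotoneOn_of_hasDerivWithinAt_nonneg (convex_Icc 0 t)
      (fun s hs => (hd s hs).continuousWithinAt)
      (fun s hs => (hd s (interior_subset hs)).mono interior_subset) fun s hs => ?_
    have := mul_nonneg (sub_nonneg.2 (hle s (interior_subset hs))) (Real.exp_pos (C * s)).le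
    linarith
  have h := hmono (left_mem_Icc.2 ht) (right_mem_Icc.2 ht) ht
  simp only [mul_zero, Real.exp_zero, mul_one] at h
  rw [Real.exp_neg, ← div_eq_mul_inv]
  exact (div_le_iff₀ (Real.exp_pos _)).2 h

end AutonomousODE

section ReducedSystem

open Set

/-- The cone of triples `(a, b, c)` for which `M_κ(a,b,c)` is positive definite. -/
def posCone (κ : ℝ) : Set (ℝ × ℝ × ℝ) :=
  {x | 0 < x.1 ∧ 0 < x.1 - x.2.2 ∧ 0 < x.1 * (x.1 + (κ - 1) * x.2.2) - κ * x.2.1 ^ 2}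

/-- The vector field induced by `F` on the coefficients `(a, b, c)`. -/
noncomputable def coeffField (κ α β : ℝ) (x : ℝ × ℝ × ℝ) : ℝ × ℝ × ℝ :=
  (2 - 2 * α * x.1 - 2 * β * x.2.1,
    -(2 * α * x.2.1) - 2 * (β / κ) * (x.1 + (κ - 1) * x.2.2),
    -(2 * α * x.2.2) - 2 * β * x.2.1 +
      2 * (β * (κ - 1) / κ) * (fFun x.1 x.2.1 x.2.2 * (x.1 - x.2.2)))

theorem mul_sub_lt_of_mem_posCone {κ a b c : ℝ} (h : (a, b, c) ∈ posCone κ) :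
    (κ - 1) * (a * (a - c)) < κ * (a ^ 2 - b ^ 2) := by
  have := h.2.2
  simp only at this
  linarith

theorem sq_sub_sq_pos_of_mem_posCone {κ a b c : ℝ} (hκ : 2 ≤ κ) (h : (a, b, c) ∈ posCone κ) :
    0 < a ^ 2 - b ^ 2 := by
  have h1 := mul_sub_lt_of_mem_posCone h
  have h2 : 0 < (κ - 1) * (a * (a - c)) := mul_pos (by linarith) (mul_pos h.1 h.2.1)
  exact pos_of_mul_pos_right (h2.trans h1) (by linarith)

theorem abs_lt_of_mem_posCone {κ a b c : ℝ} (hκ : 2 ≤ κ) (h : (a, b, c) ∈ posCone κ) :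
    |b| < a :=
  abs_lt_of_sq_lt_sq (by linarith [sq_sub_sq_pos_of_mem_posCone hκ h]) h.1.le

theorem neg_le_of_mem_posCone {κ a b c : ℝ} (hκ : 2 ≤ κ) (h : (a, b, c) ∈ posCone κ) :
    -a ≤ c := by
  have ha : 0 < a := h.1
  have h1 := h.2.2
  simp only at h1
  have h2 : 0 < a * (a + (κ - 1) * c) := by nlinarith [sq_nonneg b]
  have h3 := pos_of_mul_pos_right h2 ha.le
  nlinarith

/-- The nonlinear contribution to `α̃` is bounded on the positive definite cone. -/
theorem abs_mul_fFun_le {κ a b c : ℝ} (hκ : 2 ≤ κ) (β : ℝ) (h : (a, b, c) ∈ posCone κ) :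
    |β * (κ - 1) / κ * fFun a b c| ≤ |β| := by
  have hq := sq_sub_sq_pos_of_mem_posCone hκ h
  have hb := abs_lt_of_mem_posCone hκ h
  have h1 := mul_sub_lt_of_mem_posCone h
  have hp : 0 < a - c := h.2.1
  have hκ0 : 0 < κ := by linarith
  have hk1 : 0 ≤ κ - 1 := by linarith
  have heq : β * (κ - 1) / κ * fFun a b c =
      β * (((κ - 1) * (b * (a - c))) / (κ * (a ^ 2 - b ^ 2))) := by
    unfold fFun
    field_simp
  rw [heq, abs_mul, abs_div, abs_mul, abs_mul b, abs_of_pos hp, abs_of_nonneg hk1,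
    abs_of_pos (mul_pos hκ0 hq)]
  refine mul_le_of_le_one_right (abs_nonneg β) ((div_le_one (mul_pos hκ0 hq)).2 ?_)
  refine le_trans ?_ h1.le
  gcongr

theorem contDiffOn_coeffField (κ α β : ℝ) :
    ContDiffOn ℝ 1 (coeffField κ α β) {x | x.1 ^ 2 - x.2.1 ^ 2 ≠ 0} := by
  unfold coeffField fFun
  refine ContDiffOn.prodMk (by fun_prop) (ContDiffOn.prodMk (by fun_prop) ?_)
  refine ContDiffOn.add (by fun_prop) (contDiffOn_const.mul (ContDiffOn.mul ?_ (by fun_prop)))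
  exact ContDiffOn.div (by fun_prop) (by fun_prop) fun x hx => hx

theorem isOpen_sq_sub_sq_ne_zero : IsOpen {x : ℝ × ℝ × ℝ | x.1 ^ 2 - x.2.1 ^ 2 ≠ 0} :=
  isOpen_ne_fun (by fun_prop) (by fun_prop)

theorem posCone_subset {κ : ℝ} (hκ : 2 ≤ κ) :
    posCone κ ⊆ {x | x.1 ^ 2 - x.2.1 ^ 2 ≠ 0} :=
  fun _ hx => (sq_sub_sq_pos_of_mem_posCone hκ hx).ne'

/-- Quantitative version of `posCone`. -/
def truncatedCone (κ M δ ε : ℝ) : Set (ℝ × ℝ × ℝ) :=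
  {x | 0 ≤ x.1 ∧ x.1 ≤ M ∧ δ ≤ x.1 - x.2.2 ∧
    ε ≤ x.1 * (x.1 + (κ - 1) * x.2.2) - κ * x.2.1 ^ 2}

theorem truncatedCone_subset {κ M δ ε : ℝ} (hκ : 2 ≤ κ) (hδ : 0 < δ) (hε : 0 < ε) :
    truncatedCone κ M δ ε ⊆ posCone κ := by
  rintro ⟨a, b, c⟩ ⟨h1, -, h3, h4⟩
  simp only at h1 h3 h4
  refine ⟨h1.lt_of_ne ?_, hδ.trans_le h3, hε.trans_le h4⟩
  rintro rfl
  nlinarith [sq_nonneg b]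

theorem isCompact_truncatedCone {κ M δ ε : ℝ} (hκ : 2 ≤ κ) (hδ : 0 < δ) (hε : 0 < ε) :
    IsCompact (truncatedCone κ M δ ε) := by
  refine (isCompact_Icc (a := ((-M, -M, -M) : ℝ × ℝ × ℝ))
    (b := (M, M, M))).of_isClosed_subset ?_ ?_
  · unfold truncatedCone
    refine IsClosed.and ?_ (IsClosed.and ?_ (IsClosed.and ?_ ?_)) <;>
      exact isClosed_le (by fun_prop) (by fun_prop)
  · rintro ⟨a, b, c⟩ h
    have hc := truncatedCone_subset hκ hδ hε h
    have hb := abs_lt.1 (abs_lt_of_mem_posCone hκ hc)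
    have hc' := neg_le_of_mem_posCone hκ hc
    have hM : a ≤ M := h.2.1
    have ha : 0 < a := hc.1
    have hp : 0 < a - c := hc.2.1
    refine ⟨⟨?_, ?_, ?_⟩, ?_, ?_, ?_⟩ <;> simp only <;> linarith

theorem HasDerivWithinAt.fst_snd {E F : Type*} [NormedAddCommGroup E] [NormedSpace ℝ E]
    [NormedAddCommGroup F] [NormedSpace ℝ F] {u : ℝ → E × F} {u' : E × F} {s : Set ℝ} {t : ℝ}
    (h : HasDerivWithinAt u u' s t) :
    HasDerivWithinAt (fun r => (u r).1) u'.1 s t ∧ HasDerivWithinAt (fun r => (u r).2) u'.2 s t :=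
  ⟨(hasFDerivAt_fst (𝕜 := ℝ) (p := u t)).comp_hasDerivWithinAt t h,
    (hasFDerivAt_snd (𝕜 := ℝ) (p := u t)).comp_hasDerivWithinAt t h⟩

theorem HasDerivWithinAt.coeffs {u : ℝ → ℝ × ℝ × ℝ} {u' : ℝ × ℝ × ℝ} {s : Set ℝ} {t : ℝ}
    (h : HasDerivWithinAt u u' s t) :
    HasDerivWithinAt (fun r => (u r).1) u'.1 s t ∧
    HasDerivWithinAt (fun r => (u r).2.1) u'.2.1 s t ∧
    HasDerivWithinAt (fun r => (u r).2.2) u'.2.2 s t :=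
  ⟨h.fst_snd.1, h.fst_snd.2.fst_snd⟩

/-- A priori estimates along solutions in the positive definite cone. -/
theorem coeffField_apriori {κ : ℝ} (hκ : 2 ≤ κ) (α β : ℝ) {u : ℝ → ℝ × ℝ × ℝ} {t : ℝ}
    (ht : 0 ≤ t) (hu : ∀ s ∈ Icc 0 t, u s ∈ posCone κ ∧
      HasDerivWithinAt u (coeffField κ α β (u s)) (Icc 0 t) s) :
    1 + (u t).1 ≤ (1 + (u 0).1) * Real.exp ((2 + 2 * (|α| + |β|)) * t) ∧
    ((u 0).1 - (u 0).2.2) * Real.exp (-(2 * (|α| + |β|) * t)) ≤ (u t).1 - (u t).2.2 ∧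
    ((u 0).1 * ((u 0).1 + (κ - 1) * (u 0).2.2) - κ * (u 0).2.1 ^ 2) *
        Real.exp (-(4 * (|α| + |β|) * t)) ≤
      (u t).1 * ((u t).1 + (κ - 1) * (u t).2.2) - κ * (u t).2.1 ^ 2 := by
  have hd := fun s hs => (hu s hs).2.coeffs
  refine ⟨?_, ?_, ?_⟩
  · have key := mul_exp_neg_le_of_hasDerivWithinAt (C := -(2 + 2 * (|α| + |β|))) ht
      (fun s hs => ((hd s hs).1.const_add 1).neg) ?_
    · simp only [Pi.neg_apply, neg_mul, neg_neg] at key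
      linarith
    intro s hs
    have hc := (hu s hs).1
    simp only [Pi.neg_apply]
    generalize u s = x at hc
    obtain ⟨a, b, c⟩ := x
    have hb := abs_lt_of_mem_posCone hκ hc
    have ha : 0 < a := hc.1
    simp only [coeffField]
    have h1 : -(α * a) ≤ |α| * a := by nlinarith [neg_abs_le α]
    have h2 : -(β * b) ≤ |β| * a := by
      refine (neg_le_abs _).trans ?_
      rw [abs_mul]
      gcongr
    nlinarith [abs_nonneg α, abs_nonneg β]
  · refine mul_exp_neg_le_of_hasDerivWithinAt ht
      (fun s hs => (hd s hs).1.sub (hd s hs).2.2) ?_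
    intro s hs
    have hc := (hu s hs).1
    simp only [Pi.sub_apply]
    generalize u s = x at hc
    obtain ⟨a, b, c⟩ := x
    have hf := (abs_le.1 (abs_mul_fFun_le hκ β hc)).2
    have hp : 0 < a - c := hc.2.1
    simp only [coeffField]
    have := mul_nonneg (add_nonneg (sub_nonneg.2 (le_abs_self α)) (sub_nonneg.2 hf)) hp.le
    linarith
  · refine mul_exp_neg_le_of_hasDerivWithinAt ht
      (fun s hs => ((hd s hs).1.mul ((hd s hs).1.add ((hd s hs).2.2.const_mul (κ - 1)))).sub
        (((hd s hs).2.1.pow 2).const_mul κ)) ?_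
    intro s hs
    have hc := (hu s hs).1
    simp only [Pi.sub_apply, Pi.mul_apply, Pi.add_apply, Pi.pow_apply]
    generalize u s = x at hc
    obtain ⟨a, b, c⟩ := x
    have hf := (abs_le.1 (abs_mul_fFun_le hκ β hc)).2
    have hq := sq_sub_sq_pos_of_mem_posCone hκ hc
    have he := hc.2.2
    have ha : 0 < a := hc.1
    simp only at he
    have htr : 0 < a + (κ - 1) * c :=
      pos_of_mul_pos_right (by nlinarith [sq_nonneg b]) ha.le
    have hκ0 : κ ≠ 0 := by linarith
    have hφ : fFun a b c * (a ^ 2 - b ^ 2) = b * (a - c) := div_mul_cancel₀ _ hq.ne'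
    simp only [coeffField]
    generalize fFun a b c = φ at hf hφ
    have h1 := mul_nonneg (add_nonneg (mul_nonneg zero_le_two (sub_nonneg.2 (le_abs_self α)))
      (sub_nonneg.2 hf)) he.le
    have h2 := mul_nonneg (abs_nonneg β) he.le
    have heq : (2 - 2 * α * a - 2 * β * b) * (a + (κ - 1) * c) +
        a * (2 - 2 * α * a - 2 * β * b + (κ - 1) * (-(2 * α * c) - 2 * β * b +
          2 * (β * (κ - 1) / κ) * (φ * (a - c)))) -
        κ * (2 * b * (-(2 * α * b) - 2 * (β / κ) * (a + (κ - 1) * c))) =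
        2 * (a + (a + (κ - 1) * c)) - 2 * (2 * α + β * (κ - 1) / κ * φ) *
          (a * (a + (κ - 1) * c) - κ * b ^ 2) := by
      have hφ' : β * (κ - 1) * (φ * (a ^ 2 - b ^ 2)) = β * (κ - 1) * (b * (a - c)) := by rw [hφ]
      field_simp
      linear_combination κ * hφ'
    norm_num
    nlinarith [heq, h1, h2, htr, ha]

theorem exists_coeffField_solution {κ : ℝ} (hκ : 2 ≤ κ) (α β : ℝ) {x₀ : ℝ × ℝ × ℝ}
    (hx₀ : x₀ ∈ posCone κ) :
    ∃ u : ℝ → ℝ × ℝ × ℝ, u 0 = x₀ ∧ ∀ t, 0 ≤ t → u t ∈ posCone κ ∧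
      HasDerivWithinAt u (coeffField κ α β (u t)) (Ici 0) t := by
  refine exists_hasDerivWithinAt_Ici_of_Icc isOpen_sq_sub_sq_ne_zero
    (contDiffOn_coeffField κ α β) (posCone_subset hκ) fun T hT => ?_
  obtain ⟨h1, h2, h3⟩ := hx₀
  set C := |α| + |β|
  have hC : 0 ≤ C := by positivity
  set p := x₀.1 - x₀.2.2
  set e := x₀.1 * (x₀.1 + (κ - 1) * x₀.2.2) - κ * x₀.2.1 ^ 2
  set M := (1 + x₀.1) * Real.exp ((2 + 2 * C) * T)
  set δ := p * Real.exp (-(2 * C * T)) / 2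
  set ε := e * Real.exp (-(4 * C * T)) / 2
  have hδ : 0 < δ := by positivity
  have hε : 0 < ε := by positivity
  have hsub := truncatedCone_subset (M := M) hκ hδ hε
  let O : Set (ℝ × ℝ × ℝ) := {x | 0 < x.1 ∧ x.1 < M ∧ δ < x.1 - x.2.2 ∧
    ε < x.1 * (x.1 + (κ - 1) * x.2.2) - κ * x.2.1 ^ 2}
  have hO : IsOpen O := by
    refine IsOpen.and ?_ (IsOpen.and ?_ (IsOpen.and ?_ ?_)) <;>
      exact isOpen_lt (by fun_prop) (by fun_prop)
  have hbound : ∀ t ∈ Icc 0 T, ∀ x : ℝ × ℝ × ℝ, 0 < x.1 →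
      1 + x.1 ≤ (1 + x₀.1) * Real.exp ((2 + 2 * C) * t) →
      p * Real.exp (-(2 * C * t)) ≤ x.1 - x.2.2 →
      e * Real.exp (-(4 * C * t)) ≤ x.1 * (x.1 + (κ - 1) * x.2.2) - κ * x.2.1 ^ 2 → x ∈ O := by
    intro t ht x hx hM hp he
    have i1 : (1 + x₀.1) * Real.exp ((2 + 2 * C) * t) ≤ M := by
      have := ht.2
      simp only [M]
      gcongr
    have i2 : p * Real.exp (-(2 * C * T)) ≤ p * Real.exp (-(2 * C * t)) := by
      have := ht.2
      gcongr
    have i3 : e * Real.exp (-(4 * C * T)) ≤ e * Real.exp (-(4 * C * t)) := by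
      have := ht.2
      gcongr
    refine ⟨hx, by linarith, ?_, ?_⟩
    · linarith [show p * Real.exp (-(2 * C * T)) = 2 * δ by simp only [δ]; ring]
    · linarith [show e * Real.exp (-(4 * C * T)) = 2 * ε by simp only [ε]; ring]
  obtain ⟨u, hu0, hu⟩ := exists_hasDerivWithinAt_Icc_of_apriori (O := O) (x₀ := x₀)
    isOpen_sq_sub_sq_ne_zero (contDiffOn_coeffField κ α β) (isCompact_truncatedCone hκ hδ hε)
    (hsub.trans (posCone_subset hκ)) hO
    (fun x hx => ⟨hx.1.le, hx.2.1.le, hx.2.2.1.le, hx.2.2.2.le⟩)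
    (hbound 0 (left_mem_Icc.2 hT) x₀ h1 (by simp) (by simp [p]) (by simp [e])) hT
    (fun u t ht hu0 hu => by
      obtain ⟨b1, b2, b3⟩ := coeffField_apriori hκ α β ht.1 fun s hs =>
        ⟨hsub (hu s hs).1, (hu s hs).2⟩
      rw [hu0] at b1 b2 b3
      exact hbound t ht (u t) (hsub (hu t (right_mem_Icc.2 ht.1)).1).1 b1 b2 b3)
  exact ⟨u, hu0, fun t ht => ⟨hsub (hu t ht).1, (hu t ht).2⟩⟩

end ReducedSystem

section CoefficientMatrix

theorem Mmat_posDef_iff {κ : ℕ} (hκ : 2 ≤ κ) (a b c : ℝ) :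
    (Mmat κ a b c).PosDef ↔ (a, b, c) ∈ posCone κ := by
  have hκ0 : (0 : ℝ) < κ := by exact_mod_cast (by omega : 0 < κ)
  have hquad : ∀ x : Fin (κ + 1) → ℝ, x ⬝ᵥ (Mmat κ a b c *ᵥ x) =
      a * x 0 ^ 2 + 2 * b * x 0 * ∑ i : Fin κ, x i.succ + (a - c) * ∑ i : Fin κ, x i.succ ^ 2 +
        c * (∑ i : Fin κ, x i.succ) ^ 2 := by
    intro x
    have hrow : ∀ i : Fin κ, (Mmat κ a b c *ᵥ x) i.succ =
        b * x 0 + (a - c) * x i.succ + c * ∑ j : Fin κ, x j.succ := by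
      intro i
      have hentry : ∀ j : Fin κ, Mmat κ a b c i.succ j.succ * x j.succ =
          (if i = j then (a - c) * x j.succ else 0) + c * x j.succ := by
        intro j
        by_cases h : i = j
        · simp [Mmat, h]; ring
        · simp [Mmat, h]
      rw [mulVec, dotProduct, Fin.sum_univ_succ, Finset.sum_congr rfl fun j _ => hentry j,
        Finset.sum_add_distrib, Finset.sum_ite_eq, ← Finset.mul_sum]
      simp [Mmat, add_assoc]
    have hrow0 : (Mmat κ a b c *ᵥ x) 0 = a * x 0 + b * ∑ j : Fin κ, x j.succ := by
      rw [mulVec, dotProduct, Fin.sum_univ_succ, Finset.mul_sum]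
      simp [Mmat, (Fin.succ_ne_zero _).symm]
    rw [dotProduct, Fin.sum_univ_succ, hrow0]
    simp only [hrow]
    have hsum : ∑ i : Fin κ, x i.succ * (b * x 0 + (a - c) * x i.succ +
        c * ∑ j : Fin κ, x j.succ) = (b * x 0 + c * ∑ j : Fin κ, x j.succ) *
          ∑ i : Fin κ, x i.succ + (a - c) * ∑ i : Fin κ, x i.succ ^ 2 := by
      generalize c * ∑ j : Fin κ, x j.succ = d
      rw [Finset.mul_sum, Finset.mul_sum, ← Finset.sum_add_distrib]
      exact Finset.sum_congr rfl fun i _ => by ring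
    rw [hsum]
    ring
  constructor
  · intro h
    have hpos : ∀ x : Fin (κ + 1) → ℝ, x ≠ 0 → 0 < x ⬝ᵥ (Mmat κ a b c *ᵥ x) := by
      intro x hx
      simpa using h.dotProduct_mulVec_pos hx
    have ha : 0 < a := by
      have := hpos (Pi.single 0 1) (by simp)
      rw [hquad] at this
      simpa [Fin.succ_ne_zero] using this
    refine ⟨ha, ?_, ?_⟩
    · let i : Fin κ := ⟨0, by omega⟩
      let j : Fin κ := ⟨1, by omega⟩
      have hij : i ≠ j := by simp [i, j, Fin.ext_iff]
      have hne : (Fin.cons 0 (Pi.single i 1 - Pi.single j 1) : Fin (κ + 1) → ℝ) ≠ 0 := by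
        intro h0
        have := congrFun h0 i.succ
        simp [hij] at this
      have := hpos _ hne
      rw [hquad] at this
      have hsq : ∀ k : Fin κ, ((Pi.single i 1 : Fin κ → ℝ) k - (Pi.single j 1 : Fin κ → ℝ) k) ^ 2
          = (Pi.single i 1 : Fin κ → ℝ) k + (Pi.single j 1 : Fin κ → ℝ) k := by
        intro k
        by_cases h1 : k = i
        · subst h1; simp [hij]
        · by_cases h2 : k = j
          · subst h2; simp [h1]
          · simp [h1, h2]
      simp [hsq, Finset.sum_add_distrib] at this
      simpa using this
    · have hne : (Fin.cons (-(κ * b)) (fun _ => a) : Fin (κ + 1) → ℝ) ≠ 0 := by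
        intro h0
        have := congrFun h0 (Fin.succ ⟨0, by omega⟩)
        rw [Fin.cons_succ] at this
        exact ha.ne' this
      have := hpos _ hne
      rw [hquad] at this
      simp at this
      have h2 : 0 < (κ * a) * (a * (a + (κ - 1) * c) - κ * b ^ 2) := by
        calc (0 : ℝ) < _ := this
          _ = _ := by ring
      exact pos_of_mul_pos_right h2 (by positivity)
  · rintro ⟨ha, hp, he⟩
    simp only at ha hp he
    refine PosDef.of_dotProduct_mulVec_pos ?_ fun x hx => ?_
    · ext i j
      simp [Mmat, eq_comm, or_comm]
    · rw [star_trivial, hquad]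
      set S := ∑ i : Fin κ, x i.succ with hS
      set S2 := ∑ i : Fin κ, x i.succ ^ 2 with hS2
      have hcs : S ^ 2 ≤ κ * S2 := by
        have := sq_sum_le_card_mul_sum_sq (s := Finset.univ) (f := fun i : Fin κ => x i.succ)
        simpa using this
      have hid : (κ * a) * (a * x 0 ^ 2 + 2 * b * x 0 * S + (a - c) * S2 + c * S ^ 2) =
          κ * (a * x 0 + b * S) ^ 2 + a * (a - c) * (κ * S2 - S ^ 2) +
            (a * (a + (κ - 1) * c) - κ * b ^ 2) * S ^ 2 := by ring
      refine pos_of_mul_pos_right (a := κ * a) ?_ (by positivity)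
      rw [hid]
      have t1 : 0 ≤ κ * (a * x 0 + b * S) ^ 2 := by positivity
      have t2 : 0 ≤ a * (a - c) * (κ * S2 - S ^ 2) :=
        mul_nonneg (by positivity) (by linarith)
      have t3 : 0 ≤ (a * (a + (κ - 1) * c) - κ * b ^ 2) * S ^ 2 := by positivity
      refine (add_nonneg (add_nonneg t1 t2) t3).lt_of_ne fun h0 => hx ?_
      have z3 : (a * (a + (κ - 1) * c) - κ * b ^ 2) * S ^ 2 = 0 := by linarith
      have hS0 : S = 0 := by simpa [he.ne'] using z3
      have z2 : a * (a - c) * (κ * S2 - S ^ 2) = 0 := by linarith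
      have hS20 : S2 = 0 := by simpa [ha.ne', hp.ne', hS0, hκ0.ne'] using z2
      have z1 : κ * (a * x 0 + b * S) ^ 2 = 0 := by linarith
      have hx0 : x 0 = 0 := by simpa [ha.ne', hS0, hκ0.ne'] using z1
      rw [hS2, Finset.sum_eq_zero_iff_of_nonneg fun i _ => sq_nonneg _] at hS20
      ext i
      refine Fin.cases hx0 (fun j => ?_) i
      simpa using hS20 j (Finset.mem_univ j)

theorem Mmat_apply_zero_zero (κ : ℕ) (a b c : ℝ) : Mmat κ a b c 0 0 = a := by
  simp [Mmat]

theorem Mmat_apply_zero_succ (κ : ℕ) (a b c : ℝ) (j : Fin κ) :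
    Mmat κ a b c 0 j.succ = b := by
  simp [Mmat, (Fin.succ_ne_zero _).symm]

theorem Mmat_apply_succ_zero (κ : ℕ) (a b c : ℝ) (i : Fin κ) :
    Mmat κ a b c i.succ 0 = b := by
  simp [Mmat]

theorem Mmat_apply_succ_succ (κ : ℕ) (a b c : ℝ) (i j : Fin κ) :
    Mmat κ a b c i.succ j.succ = if i = j then a else c := by
  simp [Mmat]

theorem Mmat_apply_zero_one {κ : ℕ} (hκ : 2 ≤ κ) (a b c : ℝ) : Mmat κ a b c 0 1 = b := by
  obtain ⟨k, rfl⟩ := Nat.exists_eq_add_of_le' hκ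
  exact Mmat_apply_zero_succ (k + 2) a b c 0

theorem Mmat_apply_one_two {κ : ℕ} (hκ : 2 ≤ κ) (a b c : ℝ) : Mmat κ a b c 1 2 = c := by
  obtain ⟨k, rfl⟩ := Nat.exists_eq_add_of_le' hκ
  exact (Mmat_apply_succ_succ (k + 2) a b c 0 1).trans (by simp)

theorem transpose_Mmat (κ : ℕ) (a b c : ℝ) : (Mmat κ a b c)ᵀ = Mmat κ a b c := by
  ext i j
  simp [Mmat, eq_comm, or_comm]

theorem Lmat_mul_Mmat_apply {κ : ℕ} (hκ : 0 < κ) (α β a b c : ℝ) (i j : Fin κ) :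
    (Lmat κ α β a b c * Mmat κ a b c) 0 0 = α * a + β * b ∧
    (Lmat κ α β a b c * Mmat κ a b c) 0 j.succ = α * b + β / κ * (a + (κ - 1) * c) ∧
    (Lmat κ α β a b c * Mmat κ a b c) i.succ 0 =
      betaTilde κ α β a b c * a + alphaTilde κ α β a b c * b ∧
    (Lmat κ α β a b c * Mmat κ a b c) i.succ j.succ =
      betaTilde κ α β a b c * b + alphaTilde κ α β a b c * (if i = j then a else c) := by
  have hκ0 : (κ : ℝ) ≠ 0 := by exact_mod_cast hκ.ne'
  have h00 : Lmat κ α β a b c 0 0 = α := by simp [Lmat, Qmat, Pmat]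
  have h0s : ∀ k : Fin κ, Lmat κ α β a b c 0 k.succ = β / κ := fun k => by
    simp [Lmat, Qmat, Pmat, one_apply, (Fin.succ_ne_zero _).symm]
  have hs0 : Lmat κ α β a b c i.succ 0 = betaTilde κ α β a b c := by
    simp [Lmat, Qmat, Pmat, one_apply]
  have hss : ∀ k : Fin κ, Lmat κ α β a b c i.succ k.succ =
      if i = k then alphaTilde κ α β a b c else 0 := fun k => by
    simp [Lmat, Qmat, Pmat, one_apply]
  have hsum : ∑ k : Fin κ, (if k = j then a else c) = a + (κ - 1) * c := by
    have : ∀ k : Fin κ, (if k = j then a else c) = (if k = j then a - c else 0) + c := fun k => by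
      split_ifs <;> ring
    simp only [this, Finset.sum_add_distrib, Finset.sum_ite_eq', Finset.mem_univ, if_true,
      Finset.sum_const, Finset.card_univ, Fintype.card_fin, nsmul_eq_mul]
    ring
  simp only [mul_apply, Fin.sum_univ_succ, h00, h0s, hs0, hss, Mmat_apply_zero_zero,
    Mmat_apply_zero_succ, Mmat_apply_succ_zero, Mmat_apply_succ_succ, ← Finset.mul_sum, hsum]
  refine ⟨?_, trivial, ?_, ?_⟩
  · simp
    field_simp
  · simp
  · simp only [ite_mul, zero_mul, Finset.sum_ite_eq, Finset.mem_univ, if_true]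

theorem FmatA_Mmat {κ : ℕ} (hκ : 2 ≤ κ) (α β : ℝ) {a b c : ℝ} (hq : a ^ 2 - b ^ 2 ≠ 0) :
    FmatA κ α β (Mmat κ a b c) =
      Mmat κ (coeffField κ α β (a, b, c)).1 (coeffField κ α β (a, b, c)).2.1
        (coeffField κ α β (a, b, c)).2.2 := by
  have hκ0 : (κ : ℝ) ≠ 0 := by exact_mod_cast (by omega : κ ≠ 0)
  have hL := Lmat_mul_Mmat_apply (by omega : 0 < κ) α β a b c
  have hgb : gFun a b c * b + fFun a b c * a = b := by
    unfold gFun fFun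
    field_simp
    ring
  have hga : gFun a b c * a + fFun a b c * b = c := by
    unfold gFun fFun
    field_simp
    ring
  have hF : FmatA κ α β (Mmat κ a b c) = (2 : ℝ) • (1 : Matrix (Fin (κ + 1)) (Fin (κ + 1)) ℝ) -
      Lmat κ α β a b c * Mmat κ a b c - (Lmat κ α β a b c * Mmat κ a b c)ᵀ := by
    rw [FmatA, LmatA, Mmat_apply_zero_zero, Mmat_apply_zero_one hκ, Mmat_apply_one_two hκ,
      transpose_mul, transpose_Mmat]
  have hba : betaTilde κ α β a b c * a + alphaTilde κ α β a b c * b =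
      α * b + β / κ * (a + (κ - 1) * c) := by
    unfold betaTilde alphaTilde
    linear_combination (β * (κ - 1) / κ) * hga
  have hbb : betaTilde κ α β a b c * b + alphaTilde κ α β a b c * a = α * a + β * b := by
    unfold betaTilde alphaTilde
    have : β / κ * b + β * (κ - 1) / κ * b = β * b := by field_simp; ring
    linear_combination (β * (κ - 1) / κ) * hgb + this
  have hbc : betaTilde κ α β a b c * b + alphaTilde κ α β a b c * c =
      α * c + β * b - β * (κ - 1) / κ * (fFun a b c * (a - c)) := by
    have hα : alphaTilde κ α β a b c = α + β * (κ - 1) / κ * fFun a b c := rfl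
    linear_combination hbb - (a - c) * hα
  rw [hF]
  ext i j
  simp only [Matrix.sub_apply, Matrix.smul_apply, transpose_apply, smul_eq_mul, one_apply]
  refine Fin.cases ?_ (fun i => ?_) i <;> refine Fin.cases ?_ (fun j => ?_) j
  · rw [(hL ⟨0, by omega⟩ ⟨0, by omega⟩).1, Mmat_apply_zero_zero]
    simp only [coeffField, if_true]
    ring
  · rw [(hL j j).2.1, (hL j j).2.2.1, Mmat_apply_zero_succ, if_neg (Fin.succ_ne_zero j).symm, hba]
    simp only [coeffField]
    ring
  · rw [(hL i i).2.1, (hL i i).2.2.1, Mmat_apply_succ_zero, if_neg (Fin.succ_ne_zero i), hba]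
    simp only [coeffField]
    ring
  · rw [(hL i j).2.2.2, (hL j i).2.2.2, Mmat_apply_succ_succ]
    by_cases h : i = j
    · simp only [h, if_true, coeffField, hbb]
      ring
    · rw [if_neg h, if_neg h, if_neg (Ne.symm h), if_neg (by simpa using h), hbc]
      simp only [coeffField]
      ring

theorem hasDerivWithinAt_Mmat {κ : ℕ} {u : ℝ → ℝ × ℝ × ℝ} {u' : ℝ × ℝ × ℝ} {s : Set ℝ} {t : ℝ}
    (h : HasDerivWithinAt u u' s t) :
    HasDerivWithinAt (fun r => Mmat κ (u r).1 (u r).2.1 (u r).2.2)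
      (Mmat κ u'.1 u'.2.1 u'.2.2) s t := by
  obtain ⟨h1, h2, h3⟩ := h.coeffs
  refine hasDerivWithinAt_pi.2 fun i => hasDerivWithinAt_pi.2 fun j => ?_
  simp only [Mmat, of_apply]
  split_ifs <;> assumption

theorem HasDerivWithinAt.matrix_apply {m n : Type*} [Fintype m] [Fintype n]
    {W : ℝ → Matrix m n ℝ} {W' : Matrix m n ℝ} {s : Set ℝ} {t : ℝ}
    (h : HasDerivWithinAt W W' s t) (i : m) (j : n) :
    HasDerivWithinAt (fun r => W r i j) (W' i j) s t :=
  hasDerivWithinAt_pi.1 (hasDerivWithinAt_pi.1 h i) j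

end CoefficientMatrix

/-- Global well-posedness of the nonlinear matrix Riccati equation
`V' = F(V)`, `V(0) = Σ₀ = M_κ(a₀,b₀,c₀)` positive definite: there is a solution on
`[0,∞)` which stays of the form `M_κ(a,b,c)` and positive definite, and it is unique
among such solutions. -/
theorem stmt9 (κ : ℕ) (hκ : 2 ≤ κ) (α β a₀ b₀ c₀ : ℝ)
    (h₀ : (Mmat κ a₀ b₀ c₀).PosDef) :
    ∃ V : ℝ → Matrix (Fin (κ + 1)) (Fin (κ + 1)) ℝ,
      (V 0 = Mmat κ a₀ b₀ c₀ ∧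
        (∀ t : ℝ, 0 ≤ t →
          (∃ a b c : ℝ, V t = Mmat κ a b c) ∧ (V t).PosDef ∧
            HasDerivWithinAt V (FmatA κ α β (V t)) (Set.Ici 0) t)) ∧
      ∀ W : ℝ → Matrix (Fin (κ + 1)) (Fin (κ + 1)) ℝ,
        (W 0 = Mmat κ a₀ b₀ c₀ ∧
          (∀ t : ℝ, 0 ≤ t →
            (∃ a b c : ℝ, W t = Mmat κ a b c) ∧ (W t).PosDef ∧
              HasDerivWithinAt W (FmatA κ α β (W t)) (Set.Ici 0) t)) →
        ∀ t : ℝ, 0 ≤ t → W t = V t := by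
  have hκ' : (2 : ℝ) ≤ κ := by exact_mod_cast hκ
  obtain ⟨u, hu0, hu⟩ := exists_coeffField_solution hκ' α β ((Mmat_posDef_iff hκ a₀ b₀ c₀).1 h₀)
  refine ⟨fun t => Mmat κ (u t).1 (u t).2.1 (u t).2.2, ⟨by simp only [hu0], fun t ht => ?_⟩, ?_⟩
  · obtain ⟨hc, hd⟩ := hu t ht
    refine ⟨⟨_, _, _, rfl⟩, (Mmat_posDef_iff hκ _ _ _).2 hc, ?_⟩
    rw [FmatA_Mmat hκ α β (posCone_subset hκ' hc)]
    exact hasDerivWithinAt_Mmat hd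
  · rintro W ⟨hW0, hW⟩ t ht
    let w : ℝ → ℝ × ℝ × ℝ := fun s => (W s 0 0, W s 0 1, W s 1 2)
    have hWw : ∀ s, 0 ≤ s → W s = Mmat κ (w s).1 (w s).2.1 (w s).2.2 := by
      intro s hs
      obtain ⟨a, b, c, h⟩ := (hW s hs).1
      simp only [w]
      rw [h, Mmat_apply_zero_zero, Mmat_apply_zero_one hκ, Mmat_apply_one_two hκ]
    have hw0 : w 0 = (a₀, b₀, c₀) := by
      simp only [w, hW0, Mmat_apply_zero_zero, Mmat_apply_zero_one hκ, Mmat_apply_one_two hκ]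
    have hwc : ∀ s, 0 ≤ s → w s ∈ posCone κ := fun s hs =>
      (Mmat_posDef_iff hκ _ _ _).1 (hWw s hs ▸ (hW s hs).2.1)
    have hwd : ∀ s, 0 ≤ s → HasDerivWithinAt w (coeffField κ α β (w s)) (Set.Ici 0) s := by
      intro s hs
      have hd := (hW s hs).2.2
      rw [hWw s hs, FmatA_Mmat hκ α β (posCone_subset hκ' (hwc s hs))] at hd
      have hd' := (hd.matrix_apply 0 0).prodMk ((hd.matrix_apply 0 1).prodMk (hd.matrix_apply 1 2))
      rwa [Mmat_apply_zero_zero, Mmat_apply_zero_one hκ, Mmat_apply_one_two hκ] at hd'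
    have heq : w t = u t := eqOn_Icc_of_contDiffOn isOpen_sq_sub_sq_ne_zero
      (contDiffOn_coeffField κ α β)
      (fun s hs => ⟨posCone_subset hκ' (hwc s hs.1), (hwd s hs.1).mono Set.Icc_subset_Ici_self⟩)
      (fun s hs => ⟨posCone_subset hκ' (hu s hs.1).1, (hu s hs.1).2.mono Set.Icc_subset_Ici_self⟩)
      (hw0.trans hu0.symm) (Set.right_mem_Icc.2 ht)
    rw [hWw t ht, heq]
end

section
/- Let α, β, σ ∈ ℝ with α > |β|, let t ≥ 0, and let r be a nonnegative integer. Define φ(t,x) := σ²·e^{−2αt−βtx} + (1 − e^{−2αt−βtx})/(α + (β/2)x). Then ∫₀¹ φ(t, 2cos(πx))·cos(rπx) dx = σ²·e^{−2tα}·I_r(−2tβ) + 2·∫₀ᵗ e^{−2sα}·I_r(−2sβ) ds. -/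
/-- `φ(t,x) = σ²·e^{−2αt−βtx} + (1 − e^{−2αt−βtx})/(α + (β/2)x)`. -/
noncomputable def phiFun (α β σ t x : ℝ) : ℝ :=
  σ ^ 2 * Real.exp (-2 * α * t - β * t * x) +
    (1 - Real.exp (-2 * α * t - β * t * x)) / (α + β / 2 * x)

/-- `I_r(y) = ∫₀¹ cos(rπx)·e^{y cos(πx)} dx`, the modified Bessel function of the first
kind of order `r`. -/
noncomputable def besselI (r : ℕ) (y : ℝ) : ℝ :=
  ∫ x in (0 : ℝ)..1, Real.cos (r * Real.pi * x) * Real.exp (y * Real.cos (Real.pi * x))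

theorem integral_exp_neg_mul {d : ℝ} (hd : d ≠ 0) (t : ℝ) :
    ∫ s in (0 : ℝ)..t, Real.exp (-d * s) = (1 - Real.exp (-d * t)) / d := by
  rw [intervalIntegral.integral_comp_mul_left Real.exp (neg_ne_zero.mpr hd), integral_exp]
  simp only [mul_zero, Real.exp_zero, smul_eq_mul]
  field_simp
  ring

theorem phiFun_two_mul_eq {α β c : ℝ} (hd : α + β * c ≠ 0) (σ t : ℝ) :
    phiFun α β σ t (2 * c) = σ ^ 2 * Real.exp (-2 * t * α) * Real.exp (-2 * t * β * c) +
      2 * ∫ s in (0 : ℝ)..t, Real.exp (-2 * s * α) * Real.exp (-2 * s * β * c) := by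
  have hexp (s : ℝ) : Real.exp (-2 * s * α) * Real.exp (-2 * s * β * c) =
      Real.exp (-(2 * (α + β * c)) * s) := by
    rw [← Real.exp_add]
    ring_nf
  rw [mul_assoc, hexp]
  simp_rw [hexp]
  rw [integral_exp_neg_mul (mul_ne_zero two_ne_zero hd), phiFun,
    show -2 * α * t - β * t * (2 * c) = -(2 * (α + β * c)) * t by ring,
    show α + β / 2 * (2 * c) = α + β * c by ring]
  field_simp

theorem add_mul_cos_pos {α β : ℝ} (hαβ : |β| < α) (θ : ℝ) : 0 < α + β * Real.cos θ := by
  have h : |β * Real.cos θ| ≤ |β| := by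
    rw [abs_mul]
    exact mul_le_of_le_one_right (abs_nonneg β) (Real.abs_cos_le_one θ)
  linarith [neg_abs_le (β * Real.cos θ)]

/-- `∫₀¹ φ(t, 2cos(πx))·cos(rπx) dx = σ²e^{−2tα}I_r(−2tβ) + 2∫₀ᵗ e^{−2sα}I_r(−2sβ) ds`. -/
theorem stmt12 (α β σ : ℝ) (hαβ : |β| < α) (t : ℝ) (ht : 0 ≤ t) (r : ℕ) :
    ∫ x in (0 : ℝ)..1, phiFun α β σ t (2 * Real.cos (Real.pi * x)) * Real.cos (r * Real.pi * x)
      = σ ^ 2 * Real.exp (-2 * t * α) * besselI r (-2 * t * β) +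
        2 * ∫ s in (0 : ℝ)..t, Real.exp (-2 * s * α) * besselI r (-2 * s * β) := by
  let F : ℝ → ℝ → ℝ := fun x s ↦ Real.exp (-2 * s * α) *
    (Real.cos (r * Real.pi * x) * Real.exp (-2 * s * β * Real.cos (Real.pi * x)))
  have hF : Continuous F.uncurry := by
    unfold F Function.uncurry
    fun_prop
  have hpt (x : ℝ) :
      phiFun α β σ t (2 * Real.cos (Real.pi * x)) * Real.cos (r * Real.pi * x) =
        σ ^ 2 * Real.exp (-2 * t * α) *
          (Real.cos (r * Real.pi * x) * Real.exp (-2 * t * β * Real.cos (Real.pi * x))) +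
        2 * ∫ s in (0 : ℝ)..t, F x s := by
    have hF' : ∫ s in (0 : ℝ)..t, F x s = Real.cos (r * Real.pi * x) *
        ∫ s in (0 : ℝ)..t,
          Real.exp (-2 * s * α) * Real.exp (-2 * s * β * Real.cos (Real.pi * x)) := by
      rw [← intervalIntegral.integral_const_mul]
      congr 1 with s
      exact mul_left_comm _ _ _
    rw [phiFun_two_mul_eq (add_mul_cos_pos hαβ _).ne', hF']
    ring
  have hswap : ∫ x in (0 : ℝ)..1, ∫ s in (0 : ℝ)..t, F x s =
      ∫ s in (0 : ℝ)..t, ∫ x in (0 : ℝ)..1, F x s :=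
    MeasureTheory.intervalIntegral_intervalIntegral_swap <|
      (hF.continuousOn.integrableOn_compact (isCompact_uIcc.prod isCompact_uIcc)).mono_set
        (Set.prod_mono Set.uIoc_subset_uIcc Set.uIoc_subset_uIcc)
  have hint : Continuous fun x ↦ ∫ s in (0 : ℝ)..t, F x s :=
    intervalIntegral.continuous_parametric_intervalIntegral_of_continuous' hF 0 t
  simp_rw [hpt]
  rw [intervalIntegral.integral_add (Continuous.intervalIntegrable (by fun_prop) _ _)
      ((hint.const_mul 2).intervalIntegrable _ _),
    intervalIntegral.integral_const_mul, intervalIntegral.integral_const_mul, hswap]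
  simp only [F, intervalIntegral.integral_const_mul, besselI]
end

section
/- Let α, β ∈ ℝ with 0 < |β| < α and let r be a nonnegative integer. Then 2·∫₀^∞ e^{−2αs}·I_r(2s|β|) ds = |β|^r / ( √(α² − β²) · (α + √(α² − β²))^r ). -/
open MeasureTheory Real Set

/-- Laplace transform of the modified Bessel function, as an integral over one half-period. -/
theorem two_mul_laplace_besselI {a b : ℝ} (hb : 0 < b) (hab : b < a) (r : ℕ) :
    2 * ∫ s in Ioi (0 : ℝ), exp (-2 * a * s) * besselI r (2 * s * b)
      = ∫ x in (0 : ℝ)..1, cos (r * π * x) / (a - b * cos (π * x)) := by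
  have hint : Integrable
      (fun p : ℝ × ℝ ↦ cos (r * π * p.2) * exp (-2 * (a - b * cos (π * p.2)) * p.1))
      ((volume.restrict (Ioi 0)).prod (volume.restrict (Ioc 0 1))) := by
    have h₁ : Integrable (fun s : ℝ ↦ exp (-2 * (a - b) * s)) (volume.restrict (Ioi 0)) :=
      integrableOn_exp_mul_Ioi (by linarith) 0
    have h₂ : Integrable (fun _ : ℝ ↦ (1 : ℝ)) (volume.restrict (Ioc 0 1)) :=
      integrable_const 1
    refine (h₁.mul_prod h₂).mono' (by fun_prop) ?_
    rw [Measure.prod_restrict]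
    filter_upwards [ae_restrict_mem (measurableSet_Ioi.prod measurableSet_Ioc)] with p hp
    have hs : 0 < p.1 := hp.1
    rw [norm_mul, norm_of_nonneg (exp_pos _).le, mul_one]
    calc ‖cos (r * π * p.2)‖ * exp (-2 * (a - b * cos (π * p.2)) * p.1)
        ≤ 1 * exp (-2 * (a - b * cos (π * p.2)) * p.1) := by
          gcongr
          exact abs_cos_le_one _
      _ ≤ exp (-2 * (a - b) * p.1) := by
          rw [one_mul]
          have : b * cos (π * p.2) ≤ b := mul_le_of_le_one_right hb.le (cos_le_one _)
          exact exp_le_exp.2 (mul_le_mul_of_nonneg_right (by linarith) hs.le)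
  have hbessel (s : ℝ) : exp (-2 * a * s) * besselI r (2 * s * b)
      = ∫ x in Ioc (0 : ℝ) 1, cos (r * π * x) * exp (-2 * (a - b * cos (π * x)) * s) := by
    rw [besselI, intervalIntegral.integral_of_le zero_le_one, ← integral_const_mul]
    congr 1 with x
    rw [mul_left_comm, ← exp_add]
    ring_nf
  simp_rw [hbessel]
  rw [integral_integral_swap hint, intervalIntegral.integral_of_le zero_le_one,
    ← integral_const_mul]
  congr 1 with x
  have hpos : 0 < a - b * cos (π * x) := by
    linarith [mul_le_of_le_one_right hb.le (cos_le_one (π * x))]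
  rw [integral_const_mul, integral_exp_mul_Ioi (by linarith)]
  simp only [mul_zero, exp_zero]
  field_simp

/-- A bounded sequence with `u (n + 1) = c * u n` and `1 < c` vanishes at `0`. -/
theorem eq_zero_of_bounded_geometric {u : ℕ → ℝ} {c M : ℝ} (hc : 1 < c)
    (hu : ∀ n, u (n + 1) = c * u n) (hM : ∀ n, |u n| ≤ M) : u 0 = 0 := by
  have hpow (n : ℕ) : u n = c ^ n * u 0 := by
    induction n with
    | zero => simp
    | succ n ih => rw [hu, ih]; ring
  by_contra h
  obtain ⟨n, hn⟩ := pow_unbounded_of_one_lt (M / |u 0|) hc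
  have hn' := hM n
  rw [hpow, abs_mul, abs_of_pos (by positivity)] at hn'
  rw [div_lt_iff₀ (abs_pos.2 h)] at hn
  linarith

/-- The Fourier cosine coefficients of `1 / (a - b cos θ)`. -/
theorem integral_cos_div_sub_mul_cos {a b : ℝ} (hb : 0 < b) (hab : b < a) (r : ℕ) :
    ∫ x in (0 : ℝ)..1, cos (r * π * x) / (a - b * cos (π * x))
      = b ^ r / (√(a ^ 2 - b ^ 2) * (a + √(a ^ 2 - b ^ 2)) ^ r) := by
  have hpos (x : ℝ) : 0 < a - b * cos (π * x) := by
    linarith [mul_le_of_le_one_right hb.le (cos_le_one (π * x))]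
  set J : ℕ → ℝ := fun n ↦ ∫ x in (0 : ℝ)..1, cos (n * π * x) / (a - b * cos (π * x)) with hJ
  have hi (n : ℕ) : IntervalIntegrable
      (fun x ↦ cos (n * π * x) / (a - b * cos (π * x))) volume 0 1 :=
    (Continuous.div (by fun_prop) (by fun_prop) fun x ↦ (hpos x).ne').intervalIntegrable _ _
  have hzero : a * J 0 - b * J 1 = 1 := by
    simp only [hJ]
    rw [← intervalIntegral.integral_const_mul, ← intervalIntegral.integral_const_mul,
      ← intervalIntegral.integral_sub ((hi 0).const_mul a) ((hi 1).const_mul b)]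
    trans ∫ _ in (0 : ℝ)..1, (1 : ℝ)
    · congr 1 with x
      have := (hpos x).ne'
      simp only [CharP.cast_eq_zero, zero_mul, cos_zero, Nat.cast_one, one_mul]
      field_simp
    · simp
  have hrec (n : ℕ) : b * (J (n + 2) + J n) = 2 * a * J (n + 1) := by
    have hcos : ∫ x in (0 : ℝ)..1, cos ((n + 1 : ℕ) * π * x) = 0 := by
      have hne : ((n + 1 : ℕ) : ℝ) * π ≠ 0 := by positivity
      rw [intervalIntegral.integral_comp_mul_left (fun x ↦ cos x) hne, integral_cos]
      simp only [mul_one, mul_zero, sin_nat_mul_pi, sin_zero, sub_zero, smul_zero]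
    have key : 2 * a * J (n + 1) - b * (J (n + 2) + J n)
        = 2 * ∫ x in (0 : ℝ)..1, cos ((n + 1 : ℕ) * π * x) := by
      simp only [hJ]
      rw [← intervalIntegral.integral_add (hi _) (hi _),
        ← intervalIntegral.integral_const_mul, ← intervalIntegral.integral_const_mul,
        ← intervalIntegral.integral_sub ((hi _).const_mul _) (((hi _).add (hi _)).const_mul b),
        ← intervalIntegral.integral_const_mul]
      congr 1 with x
      have := (hpos x).ne'
      have h₁ : cos ((n + 2 : ℕ) * π * x) + cos (n * π * x)
          = 2 * cos ((n + 1 : ℕ) * π * x) * cos (π * x) := by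
        rw [two_mul_cos_mul_cos, add_comm]
        push_cast
        ring_nf
      rw [← add_div, h₁]
      field_simp
    rw [hcos] at key
    linarith
  have hbound (n : ℕ) : |J n| ≤ 1 / (a - b) := by
    have := intervalIntegral.norm_integral_le_of_norm_le_const (a := 0) (b := 1)
      (f := fun x ↦ cos (n * π * x) / (a - b * cos (π * x))) (C := 1 / (a - b)) fun x _ ↦ by
        rw [norm_div, norm_of_nonneg (hpos x).le]
        have := mul_le_of_le_one_right hb.le (cos_le_one (π * x))
        have : 0 < a - b := by linarith
        gcongr
        exact abs_cos_le_one _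
    simpa using this
  set s := √(a ^ 2 - b ^ 2) with hs
  have hsq : s ^ 2 = a ^ 2 - b ^ 2 := sq_sqrt (by nlinarith)
  have hs0 : 0 < s := sqrt_pos.2 (by nlinarith)
  have has : 0 < a + s := by linarith
  set q := b / (a + s) with hq
  have hbq : b * q = a - s := by
    rw [hq]; field_simp; linarith
  have hqs : q * (a + s) = b := by rw [hq]; field_simp
  have hq0 : 0 < q := by positivity
  have hq1 : q < 1 := by rw [hq, div_lt_one has]; linarith
  have hstep (n : ℕ) : J (n + 2) - q * J (n + 1) = q⁻¹ * (J (n + 1) - q * J n) := by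
    have h2 : q * b * (J (n + 2) + J n) = q * (2 * a * J (n + 1)) := by
      rw [mul_assoc, hrec]
    have h3 : b * (1 + q ^ 2) = 2 * a * q := by linear_combination q * hbq - hqs
    field_simp
    refine mul_left_cancel₀ hb.ne' ?_
    linear_combination h2 - J (n + 1) * h3
  have hshift (n : ℕ) : J (n + 1) = q * J n := by
    have := eq_zero_of_bounded_geometric (u := fun k ↦ J (n + k + 1) - q * J (n + k))
      (M := 1 / (a - b) + q * (1 / (a - b))) ((one_lt_inv₀ hq0).2 hq1)
      (fun k ↦ hstep (n + k)) fun k ↦ by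
        refine (abs_sub _ _).trans (add_le_add (hbound _) ?_)
        rw [abs_mul, abs_of_pos hq0]
        exact mul_le_mul_of_nonneg_left (hbound _) hq0.le
    simpa [sub_eq_zero] using this
  have hJ0 : J 0 = 1 / s := by
    rw [hshift 0] at hzero
    rw [eq_div_iff hs0.ne']
    linear_combination hzero + J 0 * hbq
  have hJr : J r = q ^ r * (1 / s) := by
    induction r with
    | zero => simp [hJ0]
    | succ n ih => rw [hshift, ih]; ring
  change J r = _
  rw [hJr, hq, div_pow, div_mul_div_comm, mul_one, mul_comm s]


/-- For `0 < |β| < α` and `r ∈ ℕ`,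
`2∫₀^∞ e^{−2αs} I_r(2s|β|) ds = |β|^r / (√(α²−β²)(α+√(α²−β²))^r)`. -/
theorem stmt13 (α β : ℝ) (hβ : 0 < |β|) (hαβ : |β| < α) (r : ℕ) :
    2 * ∫ s in Set.Ioi (0 : ℝ), Real.exp (-2 * α * s) * besselI r (2 * s * |β|)
      = |β| ^ r /
        (Real.sqrt (α ^ 2 - β ^ 2) * (α + Real.sqrt (α ^ 2 - β ^ 2)) ^ r) := by
  rw [two_mul_laplace_besselI hβ hαβ, integral_cos_div_sub_mul_cos hβ hαβ, sq_abs]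
end

section
/- Let α, β ∈ ℝ with α > |β|, set δ := √(α² − β²), and for r = 0, 1, 2 let σ_r^π := (−β)^r/(δ·(α + δ)^r). Let Σ_π := M_2(σ₀^π, σ₁^π, σ₂^π). Then σ₀^π·σ₂^π = (σ₁^π)², det(Σ_π) = (σ₀^π − σ₂^π)·((σ₀^π)² − (σ₁^π)²) = 4/( √(α² − β²)·(α + √(α² − β²))² ) > 0, and Σ_π is positive definite. -/
/-- `σ_r^π = (−β)^r / (δ(α+δ)^r)` with `δ = √(α²−β²)`. -/
noncomputable def sigmaPi (α β : ℝ) (r : ℕ) : ℝ :=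
  (-β) ^ r / (Real.sqrt (α ^ 2 - β ^ 2) * (α + Real.sqrt (α ^ 2 - β ^ 2)) ^ r)

/-- `Σ_π = M₂(σ₀^π, σ₁^π, σ₂^π)`. -/
noncomputable def SigmaPiMat (α β : ℝ) : Matrix (Fin 3) (Fin 3) ℝ :=
  Mmat 2 (sigmaPi α β 0) (sigmaPi α β 1) (sigmaPi α β 2)

/-- The determinant of `Mmat 2 u (u * t) (u * t ^ 2)` in closed form. -/
theorem det_Mmat_two_geometric (u t : ℝ) :
    (Mmat 2 u (u * t) (u * t ^ 2)).det = u ^ 3 * (1 - t ^ 2) ^ 2 := by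
  rw [Matrix.det_fin_three]
  simp [Mmat]
  ring

/-- `Mmat 2 u (u * t) (u * t ^ 2)` is positive definite for `u > 0` and `|t| < 1`. -/
theorem posDef_Mmat_two_geometric {u t : ℝ} (hu : 0 < u) (ht : t ^ 2 < 1) :
    (Mmat 2 u (u * t) (u * t ^ 2)).PosDef := by
  refine Matrix.PosDef.of_dotProduct_mulVec_pos ?_ fun x hx => ?_
  · ext i j
    fin_cases i <;> fin_cases j <;> simp [Mmat]
  · have hform : star x ⬝ᵥ (Mmat 2 u (u * t) (u * t ^ 2)).mulVec x =
        u * ((x 0 + t * x 1 + t * x 2) ^ 2 + (1 - t ^ 2) * (x 1 ^ 2 + x 2 ^ 2)) := by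
      simp [Mmat, dotProduct, Matrix.mulVec, Fin.sum_univ_three]
      ring
    rw [hform]
    have ht' : 0 < 1 - t ^ 2 := sub_pos.2 ht
    refine mul_pos hu ?_
    by_cases h : x 1 = 0 ∧ x 2 = 0
    · have h0 : x 0 ≠ 0 := by
        intro h0
        apply hx
        ext i
        fin_cases i
        exacts [h0, h.1, h.2]
      rw [h.1, h.2]
      simp only [mul_zero, add_zero]
      positivity
    · have hpos : 0 < x 1 ^ 2 + x 2 ^ 2 := by
        rcases not_and_or.1 h with h | h <;> positivity
      positivity

/-- For `α > |β|`: `σ₀^π σ₂^π = (σ₁^π)²`,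
`det Σ_π = (σ₀^π − σ₂^π)((σ₀^π)² − (σ₁^π)²) = 4/(√(α²−β²)(α+√(α²−β²))²) > 0`, and `Σ_π`
is positive definite. -/
theorem stmt15 (α β : ℝ) (hαβ : |β| < α) :
    sigmaPi α β 0 * sigmaPi α β 2 = sigmaPi α β 1 ^ 2 ∧
    (SigmaPiMat α β).det
      = (sigmaPi α β 0 - sigmaPi α β 2) * (sigmaPi α β 0 ^ 2 - sigmaPi α β 1 ^ 2) ∧
    (SigmaPiMat α β).det
      = 4 / (Real.sqrt (α ^ 2 - β ^ 2) * (α + Real.sqrt (α ^ 2 - β ^ 2)) ^ 2) ∧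
    0 < (SigmaPiMat α β).det ∧
    (SigmaPiMat α β).PosDef := by
  have hα : 0 < α := (abs_nonneg β).trans_lt hαβ
  have hd : 0 < α ^ 2 - β ^ 2 := sub_pos.2 (sq_lt_sq.2 (by rwa [abs_of_pos hα]))
  have hδ := Real.sqrt_pos.2 hd
  have hδsq := Real.sq_sqrt hd.le
  unfold SigmaPiMat sigmaPi
  set δ := Real.sqrt (α ^ 2 - β ^ 2)
  obtain ⟨t, ht⟩ : ∃ t, t = -β / (α + δ) := ⟨_, rfl⟩
  have h0 : (-β) ^ 0 / (δ * (α + δ) ^ 0) = δ⁻¹ := by simp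
  have h1 : (-β) ^ 1 / (δ * (α + δ) ^ 1) = δ⁻¹ * t := by rw [ht]; field_simp
  have h2 : (-β) ^ 2 / (δ * (α + δ) ^ 2) = δ⁻¹ * t ^ 2 := by rw [ht]; field_simp
  have hs : 1 - t ^ 2 = 2 * δ / (α + δ) := by
    rw [ht]
    field_simp
    linear_combination -hδsq
  have ht1 : t ^ 2 < 1 := by
    rw [← sub_pos, hs]
    positivity
  have hdet : δ⁻¹ ^ 3 * (1 - t ^ 2) ^ 2 = 4 / (δ * (α + δ) ^ 2) := by
    rw [hs]
    field_simp
    norm_num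
  rw [h0, h1, h2, det_Mmat_two_geometric]
  refine ⟨by ring, by ring, hdet, ?_, posDef_Mmat_two_geometric (inv_pos.2 hδ) ht1⟩
  rw [hdet]
  positivity
end

section
/- Let α, β ∈ ℝ with α > |β|, set δ := √(α² − β²), and for r = 0, 1, 2 let σ_r^π := (−β)^r/(δ·(α + δ)^r). Let Σ_π := M_2(σ₀^π, σ₁^π, σ₂^π). Then Σ_π is invertible, (Σ_π⁻¹)_{0,0} = α, and (Σ_π⁻¹)_{1,2} = (Σ_π⁻¹)_{2,1} = 0. (The vanishing of the (1,2) entry of the precision matrix expresses that under the centered Gaussian with covariance Σ_π the two leaf coordinates are conditionally independent given the center coordinate.) -/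
/-- The closed form of the precision matrix of `Σ_π`. -/
theorem SigmaPiMat_mul_precision (α β : ℝ) (hαβ : |β| < α) :
    SigmaPiMat α β *
      !![α, β / 2, β / 2;
        β / 2, (α + Real.sqrt (α ^ 2 - β ^ 2)) / 2, 0;
        β / 2, 0, (α + Real.sqrt (α ^ 2 - β ^ 2)) / 2] = 1 := by
  have hα : 0 < α := (abs_nonneg β).trans_lt hαβ
  have hpos : 0 < α ^ 2 - β ^ 2 := sub_pos.mpr (sq_lt_sq.mpr (by rwa [abs_of_pos hα]))
  have hδ : 0 < Real.sqrt (α ^ 2 - β ^ 2) := Real.sqrt_pos.mpr hpos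
  have hsq : Real.sqrt (α ^ 2 - β ^ 2) ^ 2 = α ^ 2 - β ^ 2 := Real.sq_sqrt hpos.le
  unfold SigmaPiMat sigmaPi
  generalize Real.sqrt (α ^ 2 - β ^ 2) = δ at hδ hsq ⊢
  have hβ : β ^ 2 = (α - δ) * (α + δ) := by linear_combination hsq
  have hs : α + δ ≠ 0 := by positivity
  ext i j
  fin_cases i <;> fin_cases j <;>
    simp [Mmat, Matrix.mul_apply, Fin.sum_univ_three] <;>
    field_simp <;> grind

/-- For `α > |β|`, `Σ_π` is invertible, `(Σ_π⁻¹)₀₀ = α`, and the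
`(1,2)` and `(2,1)` entries of the precision matrix `Σ_π⁻¹` vanish (conditional
independence of the two leaves given the center). -/
theorem stmt16 (α β : ℝ) (hαβ : |β| < α) :
    IsUnit (SigmaPiMat α β).det ∧
    (SigmaPiMat α β)⁻¹ 0 0 = α ∧
    (SigmaPiMat α β)⁻¹ 1 2 = 0 ∧
    (SigmaPiMat α β)⁻¹ 2 1 = 0 := by
  have h := SigmaPiMat_mul_precision α β hαβ
  refine ⟨Matrix.isUnit_det_of_right_inverse h, ?_⟩
  rw [Matrix.inv_eq_right_inv h]
  simp
end
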